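/- arXiv:math/9906218 — 5 statements merged into one kernel-verified Lean document; each statement's English description precedes it below -/
import Mathlib

section
/- Let β = ∑_{i=0}^{∞} t^{−qⁱ} ∈ F_q((t⁻¹)). For each n ≥ 0 set Q_n = t^{qⁿ} and P_n = Q_n · ∑_{i=0}^{n} t^{−qⁱ} ∈ F_q[t]. Then |β − P_n/Q_n| = |Q_n|^{−q}. -/
open Polynomial Filter

/-- `t` inside `Fq((t⁻¹))`, realized as the Laurent series field `LaurentSeries Fq`
whose variable `X` plays the role of `t⁻¹`; thus `t = X⁻¹ = single (-1) 1`. -/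
noncomputable def tLS (Fq : Type*) [Field Fq] : LaurentSeries Fq :=
  HahnSeries.single (-1 : ℤ) 1

/-- The natural embedding `Fq[t] → Fq((t⁻¹))`. -/
noncomputable def polyToLS (Fq : Type*) [Field Fq] : Polynomial Fq →+* LaurentSeries Fq :=
  (Polynomial.aeval (tLS Fq)).toRingHom

open scoped Classical in
/-- The absolute value on `Fq((t⁻¹))`: `|f| = q^(deg f)`, where `deg f` (the largest
power of `t` occurring in `f`) equals `-f.order`, and `|0| = 0`. -/
noncomputable def absLS {Fq : Type*} [Field Fq] [Fintype Fq] (f : LaurentSeries Fq) : ℝ :=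
  if f = 0 then 0 else (Fintype.card Fq : ℝ) ^ (-f.order)

/-- The filter of pairs `(P, Q)` of polynomials with `|Q| → ∞`. -/
noncomputable def approxFilter (Fq : Type*) [Field Fq] :
    Filter (Polynomial Fq × Polynomial Fq) :=
  Filter.comap (fun PQ => PQ.2.natDegree) Filter.atTop

/-- The diophantine approximation exponent
`E(β) = limsup (-log |β - P/Q| / log |Q|)`, the limsup taken as `|Q| → ∞`. -/
noncomputable def approxExp {Fq : Type*} [Field Fq] [Fintype Fq] (β : LaurentSeries Fq) : ℝ :=
  Filter.limsup (fun PQ : Polynomial Fq × Polynomial Fq =>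
      -Real.log (absLS (β - polyToLS Fq PQ.1 / polyToLS Fq PQ.2)) /
        Real.log (absLS (polyToLS Fq PQ.2)))
    (approxFilter Fq)


open scoped Classical in
/-- The Mahler element `β = ∑_{i=0}^∞ t^(-qⁱ)` of `Fq((t⁻¹))`. -/
noncomputable def mahlerBeta (Fq : Type*) [Field Fq] (q : ℕ) : LaurentSeries Fq :=
  HahnSeries.ofPowerSeries ℤ Fq
    (PowerSeries.mk fun n => if ∃ i : ℕ, n = q ^ i then (1 : Fq) else 0)

theorem absLS_eq_of_coeff {Fq : Type*} [Field Fq] [Fintype Fq] {f : LaurentSeries Fq} {N : ℤ}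
    (hN : f.coeff N ≠ 0) (hlt : ∀ m < N, f.coeff m = 0) :
    absLS f = (Fintype.card Fq : ℝ) ^ (-N) := by
  have hf : f ≠ 0 := by
    rintro rfl
    simp at hN
  have horder : f.order = N :=
    le_antisymm (HahnSeries.order_le_of_coeff_ne_zero hN)
      ((HahnSeries.le_order_iff_forall hf).mpr hlt)
  rw [absLS, if_neg hf, horder]

theorem polyToLS_X_pow (Fq : Type*) [Field Fq] (k : ℕ) :
    polyToLS Fq (X ^ k) = HahnSeries.single (-(k : ℤ)) 1 := by
  simp [polyToLS, tLS, HahnSeries.single_pow]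

theorem polyToLS_truncation_div (Fq : Type*) [Field Fq] {q : ℕ} (hq : 0 < q) (n : ℕ) :
    polyToLS Fq (∑ i ∈ Finset.range (n + 1), X ^ (q ^ n - q ^ i)) / polyToLS Fq (X ^ q ^ n) =
      ∑ i ∈ Finset.range (n + 1), HahnSeries.single ((q ^ i : ℕ) : ℤ) (1 : Fq) := by
  have hne : polyToLS Fq (X ^ q ^ n) ≠ 0 := by
    rw [polyToLS_X_pow]
    exact HahnSeries.single_ne_zero one_ne_zero
  rw [div_eq_iff hne, map_sum, Finset.sum_mul]
  refine Finset.sum_congr rfl fun i hi => ?_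
  have hle : q ^ i ≤ q ^ n := Nat.pow_le_pow_right hq (Finset.mem_range_succ_iff.mp hi)
  rw [polyToLS_X_pow, polyToLS_X_pow, HahnSeries.single_mul_single, Nat.cast_sub hle,
    neg_sub, sub_eq_add_neg, mul_one]

open scoped Classical in
theorem mahlerBeta_coeff (Fq : Type*) [Field Fq] (q : ℕ) (m : ℤ) :
    (mahlerBeta Fq q).coeff m = if ∃ i : ℕ, m = ((q ^ i : ℕ) : ℤ) then 1 else 0 := by
  rw [mahlerBeta, PowerSeries.coeff_coe]
  split_ifs with hneg hex hex
  · obtain ⟨i, rfl⟩ := hex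
    omega
  · rfl
  · obtain ⟨i, rfl⟩ := hex
    rw [PowerSeries.coeff_mk, if_pos ⟨i, Int.natAbs_natCast _⟩]
  · rw [PowerSeries.coeff_mk, if_neg]
    rintro ⟨i, hi⟩
    exact hex ⟨i, by omega⟩

theorem truncation_coeff (Fq : Type*) [Field Fq] {q : ℕ} (hq : 1 < q) (n j : ℕ) :
    (∑ i ∈ Finset.range (n + 1), HahnSeries.single ((q ^ i : ℕ) : ℤ) (1 : Fq)).coeff
      ((q ^ j : ℕ) : ℤ) = if j ≤ n then 1 else 0 := by
  classical
  simp only [HahnSeries.coeff_sum, HahnSeries.coeff_single, Nat.cast_inj,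
    Nat.pow_right_inj hq, Finset.sum_ite_eq, Finset.mem_range, Nat.lt_succ_iff]

/-- Truncations of Mahler's series approximate it to exponent exactly `q`:
with `Qₙ = t^(qⁿ)` and `Pₙ = Qₙ · ∑_{i=0}^n t^(-qⁱ)`, one has `|β - Pₙ/Qₙ| = |Qₙ|⁻ᑫ`. -/
theorem mahlerBeta_truncation {Fq : Type*} [Field Fq] [Fintype Fq]
    (q : ℕ) (hq : q = Fintype.card Fq) (n : ℕ) :
    absLS (mahlerBeta Fq q -
        polyToLS Fq (∑ i ∈ Finset.range (n + 1), Polynomial.X ^ (q ^ n - q ^ i)) /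
          polyToLS Fq (Polynomial.X ^ q ^ n))
      = absLS (polyToLS Fq (Polynomial.X ^ q ^ n)) ^ (-(q : ℤ)) := by
  classical
  have hq1 : 1 < q := hq ▸ Fintype.one_lt_card
  have hQ : absLS (polyToLS Fq (X ^ q ^ n)) = (Fintype.card Fq : ℝ) ^ (- -((q ^ n : ℕ) : ℤ)) := by
    rw [polyToLS_X_pow]
    refine absLS_eq_of_coeff (by simp) fun m hm => ?_
    rw [HahnSeries.coeff_single_of_ne hm.ne]
  rw [hQ, polyToLS_truncation_div Fq (by omega),
    absLS_eq_of_coeff (N := ((q ^ (n + 1) : ℕ) : ℤ)), ← zpow_mul]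
  · congr 1
    push_cast
    ring
  · rw [HahnSeries.coeff_sub, mahlerBeta_coeff, truncation_coeff Fq hq1, if_pos ⟨_, rfl⟩,
      if_neg (by omega)]
    simp
  · intro m hm
    rw [HahnSeries.coeff_sub, mahlerBeta_coeff]
    split_ifs with hex
    · obtain ⟨j, rfl⟩ := hex
      have hj : j < n + 1 := (Nat.pow_lt_pow_iff_right hq1).mp (by exact_mod_cast hm)
      rw [truncation_coeff Fq hq1, if_pos (by omega), sub_self]
    · rw [HahnSeries.coeff_sum, Finset.sum_eq_zero, sub_zero]
      intro i _
      exact HahnSeries.coeff_single_of_ne fun h => hex ⟨i, h⟩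
end

section
/- For β = ∑_{i=0}^{∞} t^{−qⁱ} ∈ F_q((t⁻¹)), the diophantine approximation exponent equals the algebraic degree: E(β) = q. -/
open Polynomial Filter

section Embedding

variable {Fq : Type*} [Field Fq]

lemma polyToLS_X : polyToLS Fq X = HahnSeries.single (-1 : ℤ) 1 := by
  simp [polyToLS, tLS]

lemma coeff_polyToLS (P : Fq[X]) (n : ℤ) :
    (polyToLS Fq P).coeff n = if n ≤ 0 then P.coeff (-n).toNat else 0 := by
  induction P using Polynomial.induction_on' with
  | add P Q hP hQ =>
    rw [map_add, HahnSeries.coeff_add, hP, hQ, Polynomial.coeff_add]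
    split_ifs <;> simp
  | monomial m a =>
    have hmon : polyToLS Fq (monomial m a) = HahnSeries.single (-(m : ℤ)) a := by
      simp [← C_mul_X_pow_eq_monomial, polyToLS, tLS, HahnSeries.single_pow,
        LaurentSeries.algebraMap_apply]
    rw [hmon, HahnSeries.coeff_single, coeff_monomial]
    split_ifs <;> first | rfl | omega

lemma order_polyToLS (P : Fq[X]) : (polyToLS Fq P).order = -(P.natDegree : ℤ) := by
  rcases eq_or_ne P 0 with rfl | hP
  · simp
  have hlead : (polyToLS Fq P).coeff (-(P.natDegree : ℤ)) ≠ 0 := by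
    simpa [coeff_polyToLS] using hP
  refine le_antisymm (HahnSeries.order_le_of_coeff_ne_zero hlead) ?_
  rw [HahnSeries.le_order_iff_forall fun h => hlead (by simp [h])]
  intro j hj
  rw [coeff_polyToLS, if_pos (by omega), coeff_eq_zero_of_natDegree_lt (by omega)]

lemma polyToLS_ne_zero {P : Fq[X]} (hP : P ≠ 0) : polyToLS Fq P ≠ 0 :=
  (map_ne_zero_iff _ ((injective_iff_map_eq_zero _).2 fun Q hQ => by
    by_contra hne
    have := congrArg (fun f => HahnSeries.coeff f (-(Q.natDegree : ℤ))) hQ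
    simp [coeff_polyToLS, hne] at this)).2 hP

end Embedding

section AbsoluteValue

variable {Fq : Type*} [Field Fq] [Fintype Fq]

lemma log_absLS (f : LaurentSeries Fq) :
    Real.log (absLS f) = -(f.order * Real.log (Fintype.card Fq)) := by
  unfold absLS
  split_ifs with hf
  · simp [hf]
  · simp [Real.log_zpow]

lemma approx_ratio_eq (f : LaurentSeries Fq) (Q : Fq[X]) :
    -Real.log (absLS f) / Real.log (absLS (polyToLS Fq Q)) = f.order / Q.natDegree := by
  have hlog : Real.log (Fintype.card Fq) ≠ 0 :=
    (Real.log_pos (by exact_mod_cast Fintype.one_lt_card)).ne'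
  rw [log_absLS, log_absLS, order_polyToLS]
  push_cast
  rw [neg_neg, neg_mul, neg_neg, mul_div_mul_right _ _ hlog]

end AbsoluteValue

section Frobenius

variable {Fq : Type*} [Field Fq] [Fintype Fq]

lemma PowerSeries.expand_card (f : PowerSeries Fq) :
    f.expand (Fintype.card Fq) Fintype.card_ne_zero = f ^ Fintype.card Fq := by
  obtain ⟨p, hp⟩ := CharP.exists Fq
  obtain ⟨n, hprime, hcard⟩ := FiniteField.card Fq p
  have : Fact p.Prime := ⟨hprime⟩
  have hfrob : iterateFrobenius Fq p n = RingHom.id Fq := by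
    ext a
    rw [iterateFrobenius_def, ← hcard, FiniteField.pow_card, RingHom.id_apply]
  have h := MvPowerSeries.map_iterateFrobenius_expand p hprime.ne_zero f n
  rw [hfrob, MvPowerSeries.map_id] at h
  simp only [hcard]
  exact h

lemma LaurentSeries.sub_pow_card (f g : LaurentSeries Fq) :
    (f - g) ^ Fintype.card Fq = f ^ Fintype.card Fq - g ^ Fintype.card Fq :=
  map_sub (FiniteField.frobeniusAlgHom Fq (LaurentSeries Fq)) f g

lemma mahlerBeta_eq_add_pow :
    mahlerBeta Fq (Fintype.card Fq) =
      HahnSeries.single 1 1 + mahlerBeta Fq (Fintype.card Fq) ^ Fintype.card Fq := by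
  classical
  have hone : 1 < Fintype.card Fq := Fintype.one_lt_card
  unfold mahlerBeta
  rw [← map_pow, ← PowerSeries.expand_card, ← HahnSeries.ofPowerSeries_X, ← map_add]
  congr 1
  ext n
  rw [map_add, PowerSeries.coeff_expand, PowerSeries.coeff_X, PowerSeries.coeff_mk,
    PowerSeries.coeff_mk]
  generalize Fintype.card Fq = q at hone
  by_cases hdvd : q ∣ n
  · obtain ⟨m, rfl⟩ := hdvd
    have hne : q * m ≠ 1 := fun h => hone.ne' (Nat.eq_one_of_mul_eq_one_right h)
    have hiff : (∃ i, q * m = q ^ i) ↔ ∃ i, m = q ^ i := by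
      constructor
      · rintro ⟨_ | i, hi⟩
        · exact absurd (by simpa using hi) hne
        · exact ⟨i, Nat.eq_of_mul_eq_mul_left (by omega) (hi.trans (pow_succ' q i))⟩
      · rintro ⟨i, rfl⟩
        exact ⟨i + 1, (pow_succ' q i).symm⟩
    simp [hne, Nat.mul_div_cancel_left m (by omega : 0 < q), hiff]
  · have hiff : (∃ i, n = q ^ i) ↔ n = 1 := by
      constructor
      · rintro ⟨_ | i, hi⟩
        · simpa using hi
        · exact absurd (hi ▸ dvd_pow_self q i.succ_ne_zero) hdvd
      · rintro rfl
        exact ⟨0, by simp⟩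
    simp [hdvd, hiff]

lemma order_mahlerBeta : (mahlerBeta Fq (Fintype.card Fq)).order = 1 := by
  have hcoeff : (mahlerBeta Fq (Fintype.card Fq)).coeff 1 ≠ 0 := by
    rw [mahlerBeta, PowerSeries.coeff_coe]
    simpa using ⟨0, by simp⟩
  refine le_antisymm (HahnSeries.order_le_of_coeff_ne_zero hcoeff) ?_
  rw [HahnSeries.le_order_iff_forall fun h => hcoeff (by simp [h])]
  intro j hj
  rw [mahlerBeta, PowerSeries.coeff_coe]
  split_ifs with hneg
  · rfl
  · obtain rfl : j = 0 := by omega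
    simp [eq_comm]

/-- The truncations of `β` are the fractions `P / t ^ (q ^ n)`, with error `β ^ (q ^ (n + 1))`. -/
lemma exists_mahlerBeta_sub_eq_pow (n : ℕ) : ∃ P : Fq[X],
    mahlerBeta Fq (Fintype.card Fq) - polyToLS Fq P / polyToLS Fq (X ^ Fintype.card Fq ^ n) =
      mahlerBeta Fq (Fintype.card Fq) ^ Fintype.card Fq ^ (n + 1) := by
  have hX : polyToLS Fq X ≠ 0 := polyToLS_ne_zero X_ne_zero
  have hinv : (HahnSeries.single 1 1 : LaurentSeries Fq) = (polyToLS Fq X)⁻¹ := by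
    rw [polyToLS_X]
    exact eq_inv_of_mul_eq_one_left (by simp)
  have hβ := mahlerBeta_eq_add_pow (Fq := Fq)
  rw [hinv] at hβ
  set β := mahlerBeta Fq (Fintype.card Fq)
  set q := Fintype.card Fq with hq
  induction n with
  | zero => exact ⟨1, by simpa [sub_eq_iff_eq_add'] using hβ⟩
  | succ n ih =>
    obtain ⟨P, hP⟩ := ih
    have h := congrArg (· ^ q) hP
    simp only [hq, LaurentSeries.sub_pow_card] at h
    simp only [← hq, ← pow_mul, ← pow_succ, div_pow, ← map_pow] at h
    refine ⟨P ^ q + X ^ (q ^ (n + 1) - 1), ?_⟩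
    have hsplit : polyToLS Fq (X ^ (q ^ (n + 1) - 1)) / polyToLS Fq (X ^ q ^ (n + 1)) =
        (polyToLS Fq X)⁻¹ := by
      have hpos : 1 ≤ q ^ (n + 1) := Nat.one_le_pow _ _ Fintype.card_pos
      rw [div_eq_iff (polyToLS_ne_zero (pow_ne_zero _ X_ne_zero)), map_pow, map_pow,
        ← pow_sub_one_mul (by omega : q ^ (n + 1) ≠ 0), mul_comm, mul_assoc,
        mul_inv_cancel₀ hX, mul_one]
    rw [map_add, add_div, hsplit, ← h]
    nth_rewrite 1 [hβ]
    ring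

/-- The Liouville-type lower bound on the distance of `β` to a fraction `P / Q`. -/
lemma order_mahlerBeta_sub_le (P : Fq[X]) {Q : Fq[X]} (hQ : Q ≠ 0) :
    (mahlerBeta Fq (Fintype.card Fq) - polyToLS Fq P / polyToLS Fq Q).order ≤
      1 + Fintype.card Fq * Q.natDegree := by
  have hone : 1 < Fintype.card Fq := Fintype.one_lt_card
  have hβ := mahlerBeta_eq_add_pow (Fq := Fq)
  set β := mahlerBeta Fq (Fintype.card Fq)
  set x := polyToLS Fq P / polyToLS Fq Q
  have hQ' := polyToLS_ne_zero hQ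
  by_contra! hlt
  have hpos : 0 < (β - x).order := lt_of_le_of_lt (by positivity) hlt
  have hfrob := LaurentSeries.sub_pow_card β x
  set δ := β - x with hδ
  set q := Fintype.card Fq
  have hδq : δ + -δ ^ q ≠ 0 := by
    intro h
    have hord := congrArg HahnSeries.order (add_neg_eq_zero.1 h)
    rw [HahnSeries.order_pow, nsmul_eq_mul] at hord
    have : (1 : ℤ) < q := by exact_mod_cast hone
    nlinarith
  have hle := HahnSeries.min_order_le_order_add hδq
  rw [HahnSeries.order_neg, HahnSeries.order_pow, nsmul_eq_mul,
    min_eq_left (by nlinarith [(by exact_mod_cast hone : (1 : ℤ) < q)])] at hle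
  have hnum : (δ + -δ ^ q) * polyToLS Fq (X * Q ^ q) =
      polyToLS Fq (Q ^ q - X * (P * Q ^ (q - 1) - P ^ q)) := by
    have hinv : (HahnSeries.single 1 1 : LaurentSeries Fq) * polyToLS Fq X = 1 := by
      simp [polyToLS_X]
    have hxQ : x * polyToLS Fq Q = polyToLS Fq P := div_mul_cancel₀ _ hQ'
    have hQpow : polyToLS Fq Q ^ q = polyToLS Fq Q * polyToLS Fq Q ^ (q - 1) :=
      (mul_pow_sub_one (by omega) _).symm
    have hsub : δ + -δ ^ q = HahnSeries.single 1 1 - (x - x ^ q) := by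
      rw [hfrob, hδ]
      linear_combination hβ
    have hxQpow : x ^ q * polyToLS Fq Q ^ q = polyToLS Fq P ^ q := by rw [← mul_pow, hxQ]
    simp only [map_sub, map_mul, map_pow]
    rw [hsub]
    linear_combination polyToLS Fq Q ^ q * hinv
      - polyToLS Fq X * polyToLS Fq Q ^ (q - 1) * hxQ + polyToLS Fq X * hxQpow
      - polyToLS Fq X * x * hQpow
  have hord := congrArg HahnSeries.order hnum
  rw [HahnSeries.order_mul hδq (polyToLS_ne_zero (mul_ne_zero X_ne_zero (pow_ne_zero _ hQ))),
    order_polyToLS, order_polyToLS, natDegree_X_mul (pow_ne_zero _ hQ), natDegree_pow] at hord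
  push_cast at hord
  omega

end Frobenius

/-- **(Mahler.)** For `β = ∑ t^(-qⁱ)`, the diophantine approximation exponent equals the
algebraic degree: `E(β) = q`. -/
theorem mahlerBeta_approxExp {Fq : Type*} [Field Fq] [Fintype Fq]
    (q : ℕ) (hq : q = Fintype.card Fq) :
    approxExp (mahlerBeta Fq q) = q := by
  subst hq
  set u : Fq[X] × Fq[X] → ℝ := fun PQ =>
    -Real.log (absLS (mahlerBeta Fq (Fintype.card Fq) - polyToLS Fq PQ.1 / polyToLS Fq PQ.2)) /
      Real.log (absLS (polyToLS Fq PQ.2)) with hu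
  have hone : 1 < Fintype.card Fq := Fintype.one_lt_card
  have hupper (ε : ℝ) (hε : 0 < ε) : ∀ᶠ PQ in approxFilter Fq, u PQ ≤ Fintype.card Fq + ε := by
    obtain ⟨N, hN⟩ := exists_nat_gt (1 / ε)
    filter_upwards [tendsto_comap.eventually (eventually_ge_atTop (N + 1))] with ⟨P, Q⟩ hdeg
    dsimp only at hdeg
    have hQ : Q ≠ 0 := by
      rintro rfl
      simp at hdeg
    have hdegpos : (0 : ℝ) < Q.natDegree := by exact_mod_cast (by omega : 0 < Q.natDegree)
    have hNdeg : (N : ℝ) ≤ Q.natDegree := by exact_mod_cast (by omega : N ≤ Q.natDegree)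
    have hord : ((mahlerBeta Fq (Fintype.card Fq) - polyToLS Fq P / polyToLS Fq Q).order : ℝ) ≤
        1 + Fintype.card Fq * Q.natDegree := by exact_mod_cast order_mahlerBeta_sub_le P hQ
    have hεdeg : 1 < Q.natDegree * ε := (div_lt_iff₀ hε).1 (hN.trans_le hNdeg)
    simp only [hu, approx_ratio_eq]
    rw [div_le_iff₀ hdegpos]
    linarith
  have hlower : ∃ᶠ PQ in approxFilter Fq, (Fintype.card Fq : ℝ) ≤ u PQ := by
    refine (atTop_basis.comap _).frequently_iff.2 fun n _ => ?_
    obtain ⟨P, hP⟩ := exists_mahlerBeta_sub_eq_pow (Fq := Fq) n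
    refine ⟨(P, X ^ Fintype.card Fq ^ n), ?_, ?_⟩
    · simpa using (Nat.lt_pow_self hone).le
    · have hqpos : (0 : ℝ) < (Fintype.card Fq : ℝ) ^ n := by positivity
      simp only [hu, approx_ratio_eq, hP, HahnSeries.order_pow, order_mahlerBeta, natDegree_X_pow]
      rw [le_div_iff₀ (by exact_mod_cast hqpos)]
      simp [pow_succ']
  refine le_antisymm (le_of_forall_pos_le_add fun ε hε => ?_) ?_
  · exact limsup_le_of_le (.of_frequently_ge hlower) (hupper ε hε)
  · exact le_limsup_of_frequently_le hlower (isBoundedUnder_of_eventually_le (hupper 1 one_pos))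
end

section
/- Let K be a field equipped with a derivation D, let a, b, c ∈ K, and let x₀, x₁, x₂, x₃ ∈ K be four pairwise distinct elements each satisfying the Riccati equation D(xᵢ) = a·xᵢ² + b·xᵢ + c. Then the derivative of their cross-ratio vanishes: D( ((x₀ − x₂)(x₁ − x₃)) / ((x₀ − x₃)(x₁ − x₂)) ) = 0. -/
/-- If four pairwise distinct elements of a field `K` with a derivation `D` all satisfy
the same Riccati equation `D x = a·x² + b·x + c`, then the derivative of their
cross-ratio vanishes. -/
theorem deriv_crossRatio_eq_zero_of_riccati {K : Type*} [Field K]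
    (D : Derivation ℤ K K) (a b c : K) (x₀ x₁ x₂ x₃ : K)
    (h01 : x₀ ≠ x₁) (h02 : x₀ ≠ x₂) (h03 : x₀ ≠ x₃)
    (h12 : x₁ ≠ x₂) (h13 : x₁ ≠ x₃) (h23 : x₂ ≠ x₃)
    (hx₀ : D x₀ = a * x₀ ^ 2 + b * x₀ + c)
    (hx₁ : D x₁ = a * x₁ ^ 2 + b * x₁ + c)
    (hx₂ : D x₂ = a * x₂ ^ 2 + b * x₂ + c)
    (hx₃ : D x₃ = a * x₃ ^ 2 + b * x₃ + c) :
    D (((x₀ - x₂) * (x₁ - x₃)) / ((x₀ - x₃) * (x₁ - x₂))) = 0 := by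
  rw [Derivation.leibniz_div]
  simp only [Derivation.leibniz, map_sub, hx₀, hx₁, hx₂, hx₃, smul_eq_mul]
  refine mul_eq_zero_of_right _ ?_
  ring
end

section
/- Let F be a finite field, K = F(t) with the derivation d/dt, and let β be separable algebraic over K of degree d ≥ 4. Let L be a splitting field over K of the minimal polynomial f of β, let β = β₁, β₂, …, β_d ∈ L be the (pairwise distinct) roots of f, and let D be a derivation on L extending d/dt on K. Then the following are equivalent: (i) there exist a, b, c ∈ K with D(β) = a·β² + b·β + c (β satisfies a rational Riccati equation); (ii) for every four pairwise distinct conjugates β_i, β_j, β_k, β_l, the derivative of the cross-ratio vanishes: D( ((β_i − β_k)(β_j − β_l)) / ((β_i − β_l)(β_j − β_k)) ) = 0. -/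
open Polynomial

/-- A derivation kills every `x` with `x ^ n = x` when `n` is zero in the field. -/
theorem Derivation.eq_zero_of_pow_eq_self {L : Type*} [Field L] (D : Derivation ℤ L L) {x : L}
    {n : ℕ} (hn : (n : L) = 0) (hx : x ^ n = x) : D x = 0 := by
  rw [← hx, D.leibniz_pow, ← Nat.cast_smul_eq_nsmul L, hn, zero_smul]

/-- Over a finite field `F`, a derivation killing `t` kills `F(t)`. -/
theorem Derivation.algebraMap_ratFunc_eq_zero {F L : Type*} [Field F] [Fintype F] [Field L]
    [Algebra (RatFunc F) L] (D : Derivation ℤ L L)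
    (hX : D (algebraMap (RatFunc F) L RatFunc.X) = 0) (r : RatFunc F) :
    D (algebraMap (RatFunc F) L r) = 0 := by
  have hC (c : F) : D (algebraMap (RatFunc F) L (RatFunc.C c)) = 0 := by
    refine D.eq_zero_of_pow_eq_self (n := Fintype.card F) ?_ ?_
    · have h := congrArg ((algebraMap (RatFunc F) L).comp RatFunc.C) (Nat.cast_card_eq_zero F)
      rwa [_root_.map_natCast, map_zero] at h
    · rw [← map_pow, ← map_pow, FiniteField.pow_card]
  have hpoly (p : F[X]) : D (algebraMap (RatFunc F) L (algebraMap F[X] (RatFunc F) p)) = 0 := by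
    induction p using Polynomial.induction_on' with
    | add p q hp hq => simp only [map_add, hp, hq, add_zero]
    | monomial n c =>
      rw [← C_mul_X_pow_eq_monomial, map_mul, map_pow, RatFunc.algebraMap_C,
        RatFunc.algebraMap_X, map_mul, map_pow, D.leibniz, D.leibniz_pow, hX, hC]
      simp
  induction r using RatFunc.induction_on with
  | f p q hq => rw [map_div₀, D.leibniz_div, hpoly, hpoly]; simp

/-- A derivation of a separable algebraic extension vanishing on the base field is zero. -/
theorem Derivation.eq_zero_of_isSeparable {K L : Type*} [Field K] [Field L] [Algebra K L]
    [Algebra.IsSeparable K L] (D : Derivation ℤ L L) (hD : ∀ r : K, D (algebraMap K L r) = 0)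
    (x : L) : D x = 0 := by
  have := Algebra.FormallyUnramified.of_isSeparable K L
  have : Subsingleton (Derivation K L L) :=
    (KaehlerDifferential.linearMapEquivDerivation K L (M := L)).symm.toEquiv.subsingleton
  let E : Derivation K L L :=
    Derivation.mk' { toFun := D
                     map_add' := map_add D
                     map_smul' := fun r y => by simp [Algebra.smul_def, hD] }
      fun a b => D.leibniz a b
  exact congrArg (fun E : Derivation K L L => E x) (Subsingleton.elim E 0)

/-- A derivation of a separable extension of `F(t)`, `F` finite, sending `t` to `1` commutes with
every automorphism over `F(t)`. -/
theorem Derivation.algEquiv_apply_comm {F L : Type*} [Field F] [Fintype F] [Field L]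
    [Algebra (RatFunc F) L] [Algebra.IsSeparable (RatFunc F) L] (D : Derivation ℤ L L)
    (hDt : D (algebraMap (RatFunc F) L RatFunc.X) = 1) (σ : L ≃ₐ[RatFunc F] L) (x : L) :
    D (σ x) = σ (D x) := by
  let E : Derivation ℤ L L :=
    Derivation.mk' { toFun := fun y => σ.symm (D (σ y)) - D y
                     map_add' := fun y z => by simp only [map_add]; ring
                     map_smul' := fun n y => by simp [smul_sub] }
      fun a b => by simp; ring
  have hE : E x = 0 := E.eq_zero_of_isSeparable (K := RatFunc F)
    (E.algebraMap_ratFunc_eq_zero (by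
      change σ.symm (D (σ _)) - D _ = 0
      simp only [AlgEquiv.commutes, hDt, map_one, sub_self])) x
  rw [← sub_eq_zero.mp (show σ.symm (D (σ x)) - D x = 0 from hE), AlgEquiv.apply_symm_apply]

/-- If three of four distinct points satisfy a Riccati equation, then their cross-ratio is constant
exactly when the fourth one does. -/
theorem Derivation.crossRatio_eq_zero_iff {L : Type*} [Field L] (D : Derivation ℤ L L)
    {a b c x y z w : L} (hxy : x ≠ y) (hxz : x ≠ z) (hxw : x ≠ w) (hyz : y ≠ z)
    (hx : D x = a * x ^ 2 + b * x + c) (hy : D y = a * y ^ 2 + b * y + c)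
    (hz : D z = a * z ^ 2 + b * z + c) :
    D (((x - z) * (y - w)) / ((x - w) * (y - z))) = 0 ↔ D w = a * w ^ 2 + b * w + c := by
  have key : ((x - w) * (y - z)) * D ((x - z) * (y - w)) -
      ((x - z) * (y - w)) * D ((x - w) * (y - z)) =
      ((x - z) * (y - z) * (x - y)) * (a * w ^ 2 + b * w + c - D w) := by
    simp only [D.leibniz, map_sub, smul_eq_mul, hx, hy, hz]
    ring
  rw [D.leibniz_div, smul_eq_mul, smul_eq_mul, smul_eq_mul, key]
  have hne := mul_ne_zero (sub_ne_zero.mpr hxw) (sub_ne_zero.mpr hyz)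
  rw [mul_eq_zero_iff_left (pow_ne_zero 2 (inv_ne_zero hne)), mul_eq_zero_iff_left
    (mul_ne_zero (mul_ne_zero (sub_ne_zero.mpr hxz) (sub_ne_zero.mpr hyz)) (sub_ne_zero.mpr hxy)),
    sub_eq_zero, eq_comm]

/-- Quadratic interpolation through three points. -/
theorem exists_quadratic_interpolation {L : Type*} [Field L] {x y z : L} (hxy : x ≠ y)
    (hxz : x ≠ z) (hyz : y ≠ z) (u v w : L) :
    ∃ a b c : L, u = a * x ^ 2 + b * x + c ∧ v = a * y ^ 2 + b * y + c ∧
      w = a * z ^ 2 + b * z + c := by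
  have hyx := sub_ne_zero.mpr hxy.symm
  have hzx := sub_ne_zero.mpr hxz.symm
  have hzy := sub_ne_zero.mpr hyz.symm
  obtain ⟨m, hm⟩ : ∃ m, m * (y - x) = v - u := ⟨_, div_mul_cancel₀ _ hyx⟩
  obtain ⟨a, ha⟩ : ∃ a, a * ((z - x) * (z - y)) = w - u - m * (z - x) :=
    ⟨_, div_mul_cancel₀ _ (mul_ne_zero hzx hzy)⟩
  refine ⟨a, m - a * (x + y), u - m * x + a * x * y, by ring, ?_, ?_⟩
  · linear_combination -hm
  · linear_combination -ha

/-- The coefficients of a quadratic are determined by its values at three points. -/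
theorem quadratic_coeff_unique {L : Type*} [Field L] {x y z : L} (hxy : x ≠ y)
    (hxz : x ≠ z) (hyz : y ≠ z) {a b c a' b' c' : L}
    (hx : a * x ^ 2 + b * x + c = a' * x ^ 2 + b' * x + c')
    (hy : a * y ^ 2 + b * y + c = a' * y ^ 2 + b' * y + c')
    (hz : a * z ^ 2 + b * z + c = a' * z ^ 2 + b' * z + c') :
    a = a' ∧ b = b' ∧ c = c' := by
  have h₁ : (a - a') * (x + y) + (b - b') = 0 :=
    mul_left_cancel₀ (sub_ne_zero.mpr hxy) (by linear_combination hx - hy)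
  have h₂ : (a - a') * (x + z) + (b - b') = 0 :=
    mul_left_cancel₀ (sub_ne_zero.mpr hxz) (by linear_combination hx - hz)
  have ha : a = a' :=
    sub_eq_zero.mp (mul_left_cancel₀ (sub_ne_zero.mpr hyz) (by linear_combination h₁ - h₂))
  subst ha
  have hb : b = b' := by linear_combination h₁
  subst hb
  exact ⟨rfl, rfl, by linear_combination hx⟩

/-- An injective family of `natDegree p` roots of `p` contains every root of `p`. -/
theorem Polynomial.exists_eq_of_aeval_eq_zero {K L : Type*} [Field K] [Field L] [Algebra K L]
    {p : K[X]} (hp : p ≠ 0) {d : ℕ} (hd : p.natDegree = d) {β : Fin d → L}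
    (hβ : Function.Injective β) (hroots : ∀ i, aeval (β i) p = 0) {x : L} (hx : aeval x p = 0) :
    ∃ i, β i = x := by
  classical
  have hsub : Finset.univ.image β ⊆ (p.aroots L).toFinset := by
    intro y hy
    obtain ⟨i, -, rfl⟩ := Finset.mem_image.mp hy
    simpa [hp] using hroots i
  have hcard : (p.aroots L).toFinset.card ≤ (Finset.univ.image β).card := by
    rw [Finset.card_image_of_injective _ hβ, Finset.card_fin, ← hd,
      ← natDegree_map (algebraMap K L)]
    exact (Multiset.toFinset_card_le _).trans (card_roots' _)
  have hmem : x ∈ Finset.univ.image β := by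
    rw [Finset.eq_of_subset_of_card_le hsub hcard]
    simpa [hp] using hx
  simpa using hmem

/-- **Riccati ⟺ constant cross-ratios.** Let `F` be a finite field, `K = F(t)` with the
derivation `d/dt`, `β` separable algebraic over `K` of degree `d ≥ 4`, `L` a splitting
field of the minimal polynomial `f` of `β`, `β = β ⟨0, by omega⟩, β 1, …, β (d-1)` the pairwise
distinct roots of `f` in `L`, and `D` a derivation of `L` extending `d/dt` (i.e. a
derivation with `D t = 1`; such a `D` automatically restricts to `d/dt` on `K`). Then
`β` satisfies a rational Riccati equation `D β = a·β² + b·β + c` with `a, b, c ∈ K`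
if and only if the derivative of the cross-ratio of any four pairwise distinct
conjugates of `β` vanishes. -/
theorem riccati_iff_crossRatio_deriv_eq_zero
    {F : Type*} [Field F] [Fintype F] {L : Type*} [Field L] [Algebra (RatFunc F) L]
    (d : ℕ) (hd : 4 ≤ d) (β : Fin d → L)
    (hint : IsIntegral (RatFunc F) (β ⟨0, by omega⟩))
    (hsep : (minpoly (RatFunc F) (β ⟨0, by omega⟩)).Separable)
    (hdeg : (minpoly (RatFunc F) (β ⟨0, by omega⟩)).natDegree = d)
    (hsplit : Polynomial.IsSplittingField (RatFunc F) L (minpoly (RatFunc F) (β ⟨0, by omega⟩)))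
    (hroots : ∀ i, Polynomial.aeval (β i) (minpoly (RatFunc F) (β ⟨0, by omega⟩)) = 0)
    (hdist : Function.Injective β)
    (D : Derivation ℤ L L)
    (hDt : D (algebraMap (RatFunc F) L RatFunc.X) = 1) :
    (∃ a b c : RatFunc F,
        D (β ⟨0, by omega⟩) = algebraMap (RatFunc F) L a * β ⟨0, by omega⟩ ^ 2 +
          algebraMap (RatFunc F) L b * β ⟨0, by omega⟩ + algebraMap (RatFunc F) L c) ↔
    (∀ i j k l : Fin d, i ≠ j → i ≠ k → i ≠ l → j ≠ k → j ≠ l → k ≠ l →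
        D (((β i - β k) * (β j - β l)) / ((β i - β l) * (β j - β k))) = 0) := by
  have hgal : IsGalois (RatFunc F) L := IsGalois.of_separable_splitting_field hsep
  have hcomm := D.algEquiv_apply_comm hDt
  constructor
  · rintro ⟨a, b, c, h⟩ i j k l hij hik hil hjk hjl hkl
    have hall (m : Fin d) : D (β m) = algebraMap (RatFunc F) L a * β m ^ 2 +
        algebraMap (RatFunc F) L b * β m + algebraMap (RatFunc F) L c := by
      obtain ⟨σ, hσ⟩ := (isConjRoot_of_aeval_eq_zero hint (hroots m)).symm.exists_algEquiv
      rw [← hσ, hcomm, h]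
      simp
    exact (D.crossRatio_eq_zero_iff (hdist.ne hij) (hdist.ne hik) (hdist.ne hil) (hdist.ne hjk)
      (hall i) (hall j) (hall k)).mpr (hall l)
  · intro h
    have hfin := IsSplittingField.finiteDimensional L (minpoly (RatFunc F) (β ⟨0, _⟩))
    obtain ⟨i, hi⟩ : ∃ i : Fin d, i = ⟨0, by omega⟩ := ⟨_, rfl⟩
    obtain ⟨j, hj⟩ : ∃ j : Fin d, j = ⟨1, by omega⟩ := ⟨_, rfl⟩
    obtain ⟨k, hk⟩ : ∃ k : Fin d, k = ⟨2, by omega⟩ := ⟨_, rfl⟩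
    have hij : i ≠ j := by simp [hi, hj]
    have hik : i ≠ k := by simp [hi, hk]
    have hjk : j ≠ k := by simp [hj, hk]
    obtain ⟨a, b, c, hDi, hDj, hDk⟩ := exists_quadratic_interpolation (hdist.ne hij)
      (hdist.ne hik) (hdist.ne hjk) (D (β i)) (D (β j)) (D (β k))
    have hall (m : Fin d) : D (β m) = a * β m ^ 2 + b * β m + c := by
      rcases eq_or_ne i m with rfl | hmi
      · exact hDi
      rcases eq_or_ne j m with rfl | hmj
      · exact hDj
      rcases eq_or_ne k m with rfl | hmk
      · exact hDk
      exact (D.crossRatio_eq_zero_iff (hdist.ne hij) (hdist.ne hik) (hdist.ne hmi) (hdist.ne hjk)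
        hDi hDj hDk).mp (h i j k m hij hik hmi hjk hmj hmk)
    have hconj (σ : L ≃ₐ[RatFunc F] L) (m : Fin d) :
        D (β m) = σ a * β m ^ 2 + σ b * β m + σ c := by
      obtain ⟨n, hn⟩ := exists_eq_of_aeval_eq_zero (minpoly.ne_zero hint) hdeg hdist hroots
        (x := σ.symm (β m)) (by rw [← AlgEquiv.coe_toAlgHom, aeval_algHom_apply, hroots, map_zero])
      have hm : β m = σ (β n) := by rw [hn, AlgEquiv.apply_symm_apply]
      rw [hm, hcomm, hall]
      simp
    have hfix (σ : L ≃ₐ[RatFunc F] L) : σ a = a ∧ σ b = b ∧ σ c = c :=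
      quadratic_coeff_unique (hdist.ne hij) (hdist.ne hik) (hdist.ne hjk)
        ((hconj σ i).symm.trans (hall i)) ((hconj σ j).symm.trans (hall j))
        ((hconj σ k).symm.trans (hall k))
    obtain ⟨a', ha⟩ := (IsGalois.mem_range_algebraMap_iff_fixed a).mpr fun σ => (hfix σ).1
    obtain ⟨b', hb⟩ := (IsGalois.mem_range_algebraMap_iff_fixed b).mpr fun σ => (hfix σ).2.1
    obtain ⟨c', hc⟩ := (IsGalois.mem_range_algebraMap_iff_fixed c).mpr fun σ => (hfix σ).2.2
    exact ⟨a', b', c', by rw [ha, hb, hc]; exact hall _⟩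
end

section
/- Let F be a finite field of characteristic 2, K = F(t) with the derivation ′ = d/dt, and let β be separable algebraic of degree 4 over K satisfying β⁴ + aβ³ + bβ² + cβ + e = 0 with a, b, c, e ∈ K. Let D be the unique extension of d/dt to a derivation of K(β). If there exist α, γ, δ ∈ K with D(β) = αβ² + γβ + δ (i.e. β satisfies a rational Riccati equation), then a·c′ = a′·c. -/
open Polynomial in
/-- A vanishing cubic expression in an element of degree `4` has zero coefficients; here only the
coefficients of `x ^ 3` and `x` are recorded. -/
theorem coeff_three_one_eq_zero_of_natDegree_minpoly_eq_four {K L : Type*} [Field K] [Field L]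
    [Algebra K L] {x : L} (hdeg : (minpoly K x).natDegree = 4) {p q r s : K}
    (h : algebraMap K L p * x ^ 3 + algebraMap K L q * x ^ 2 + algebraMap K L r * x +
      algebraMap K L s = 0) : p = 0 ∧ r = 0 := by
  have hzero : C p * X ^ 3 + C q * X ^ 2 + C r * X + C s = 0 := by
    by_contra hne
    have hle := natDegree_le_of_dvd (minpoly.dvd K x (by simpa using h)) hne
    have := natDegree_cubic_le (a := p) (b := q) (c := r) (d := s)
    omega
  constructor
  · simpa [coeff_X, coeff_C] using congrArg (coeff · 3) hzero
  · simpa [coeff_X, coeff_C] using congrArg (coeff · 1) hzero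

/-- In characteristic `2`, if `β` is separable algebraic of degree `4` over `K = F(t)`
satisfying `β⁴ + aβ³ + bβ² + cβ + e = 0` with `a, b, c, e ∈ K`, and `β` satisfies a
rational Riccati equation `D β = αβ² + γβ + δ` (`α, γ, δ ∈ K`), where `D` is the
extension to `K(β)` of the derivation `d/dt` of `K` (the derivation `D₀` with
`D₀ t = 1`), then `a·c' = a'·c`. -/
theorem riccati_char_two_degree_four {F : Type*} [Field F] [Fintype F] [CharP F 2]
    {L : Type*} [Field L] [Algebra (RatFunc F) L]
    (D₀ : Derivation ℤ (RatFunc F) (RatFunc F)) (hD₀ : D₀ RatFunc.X = 1)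
    (D : Derivation ℤ L L)
    (hD : ∀ r : RatFunc F, D (algebraMap (RatFunc F) L r) = algebraMap (RatFunc F) L (D₀ r))
    (β : L) (hint : IsIntegral (RatFunc F) β)
    (hsep : (minpoly (RatFunc F) β).Separable)
    (hdeg : (minpoly (RatFunc F) β).natDegree = 4)
    (a b c e : RatFunc F)
    (heq : β ^ 4 + algebraMap (RatFunc F) L a * β ^ 3 + algebraMap (RatFunc F) L b * β ^ 2 +
      algebraMap (RatFunc F) L c * β + algebraMap (RatFunc F) L e = 0)
    (hric : ∃ α γ δ : RatFunc F,
      D β = algebraMap (RatFunc F) L α * β ^ 2 + algebraMap (RatFunc F) L γ * β +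
        algebraMap (RatFunc F) L δ) :
    a * D₀ c = D₀ a * c := by
  obtain ⟨α, γ, δ, hβ⟩ := hric
  have htwo : (2 : RatFunc F) = 0 := by
    have : CharP (RatFunc F) 2 :=
      charP_of_injective_algebraMap (algebraMap F (RatFunc F)).injective 2
    exact CharTwo.two_eq_zero
  have htwoL : (2 : L) = 0 := by
    rw [← map_ofNat (algebraMap (RatFunc F) L) 2, htwo, map_zero]
  have hderiv := congrArg D heq
  simp only [map_add, Derivation.leibniz, Derivation.leibniz_pow, hD, hβ, map_zero,
    smul_eq_mul, nsmul_eq_mul] at hderiv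
  push_cast at hderiv
  obtain ⟨ha, hc⟩ := coeff_three_one_eq_zero_of_natDegree_minpoly_eq_four hdeg
    (p := D₀ a + a * a * α + a * γ) (q := D₀ b + a * b * α + a * δ + c * α)
    (r := D₀ c + a * c * α + c * γ) (s := D₀ e + a * e * α + c * δ) (x := β) (by
      simp only [map_add, map_mul]
      grind)
  linear_combination a * hc - c * ha
end
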